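/- Let d ≥ 2 be an integer, m ≥ 2 a real number, and q a real number with 2 ≤ q < m/2 + 1. There exists a constant C > 0 depending only on d, m and q such that: for every C² weight f : ℝ^d → ℝ, every positive C³ solution v : ℝ^d → ℝ of the v-equation 𝓛v = (1/v)·((m/2)|∇v|² + c_m), every o ∈ ℝ^d and every R > 0, one has ∫_{B_R(o)} e^{−f} v^{−q} |∇v|² dx + ∫_{B_R(o)} e^{−f} v^{−q} dx ≤ C · (∫_{B_{2R}(o)} e^{−f} dx) · R^{−q}. [Euclidean-base instance of Lemma 5.3 i).] -/

import Mathlib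

open Real MeasureTheory Filter
open scoped RealInnerProductSpace

/-- Euclidean Laplacian: trace of the second derivative. -/
noncomputable def lapl {d : ℕ} (u : EuclideanSpace ℝ (Fin d) → ℝ)
    (x : EuclideanSpace ℝ (Fin d)) : ℝ :=
  ∑ i : Fin d, iteratedFDeriv ℝ 2 u x ![EuclideanSpace.single i 1, EuclideanSpace.single i 1]

/-- The constant c_m: 2/(m−2) for m > 2 and 1/2 for m = 2. -/
noncomputable def cm (m : ℝ) : ℝ := if m = 2 then 1/2 else 2/(m-2)


/-- Integration by parts: divergence theorem for `G ∇v` with compactly supported `G`. -/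
lemma ibp_aux {d : ℕ} (G v : EuclideanSpace ℝ (Fin d) → ℝ) (hG : ContDiff ℝ 1 G)
    (hGc : HasCompactSupport G) (hv : ContDiff ℝ 2 v) :
    (Continuous fun x => G x * lapl v x + fderiv ℝ G x (gradient v x)) ∧
    ∫ x, (G x * lapl v x + fderiv ℝ G x (gradient v x)) = 0 := by
  let e : Fin d → EuclideanSpace ℝ (Fin d) := fun i => EuclideanSpace.single i 1
  let w : Fin d → EuclideanSpace ℝ (Fin d) → ℝ := fun i x => fderiv ℝ v x (e i)
  have hw : ∀ i, ContDiff ℝ 1 (w i) := fun i =>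
    (hv.fderiv_right (m := 1) (by norm_num)).clm_apply contDiff_const
  have hlap : ∀ x, lapl v x = ∑ i, fderiv ℝ (w i) x (e i) := by
    intro x
    unfold lapl
    refine Finset.sum_congr rfl fun i _ => ?_
    rw [iteratedFDeriv_two_apply]
    have h1 : DifferentiableAt ℝ (fderiv ℝ v) x :=
      ((hv.fderiv_right (m := 1) (by norm_num)).differentiable (by norm_num)) x
    have h2 := h1.hasFDerivAt.clm_apply (hasFDerivAt_const (e i) x)
    have h3 : fderiv ℝ (w i) x = _ := h2.fderiv
    rw [h3]
    simp [e]
  have hgr : ∀ x, fderiv ℝ G x (gradient v x) = ∑ i, fderiv ℝ G x (e i) * w i x := by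
    intro x
    have h1 : gradient v x = ∑ i, w i x • e i := by
      have h := (EuclideanSpace.basisFun (Fin d) ℝ).sum_repr' (gradient v x)
      rw [← h]
      refine Finset.sum_congr rfl fun i _ => ?_
      rw [real_inner_comm]
      simp [w, e]
    rw [h1, map_sum]
    refine Finset.sum_congr rfl fun i _ => ?_
    rw [map_smul, smul_eq_mul, mul_comm]
  have hGd : Continuous (fderiv ℝ G) := hG.continuous_fderiv (by norm_num)
  have hwd : ∀ i, Continuous (fderiv ℝ (w i)) := fun i => (hw i).continuous_fderiv (by norm_num)
  have c1 : ∀ i, Continuous fun x => G x * fderiv ℝ (w i) x (e i) := fun i =>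
    hG.continuous.mul ((hwd i).clm_apply continuous_const)
  have c2 : ∀ i, Continuous fun x => fderiv ℝ G x (e i) * w i x := fun i =>
    (hGd.clm_apply continuous_const).mul (hw i).continuous
  have i1 : ∀ i, Integrable fun x => G x * fderiv ℝ (w i) x (e i) := fun i =>
    (c1 i).integrable_of_hasCompactSupport hGc.mul_right
  have i2 : ∀ i, Integrable fun x => fderiv ℝ G x (e i) * w i x := fun i =>
    (c2 i).integrable_of_hasCompactSupport (hGc.fderiv_apply ℝ (e i)).mul_right
  have i3 : ∀ i, Integrable fun x => G x * w i x := fun i =>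
    (hG.continuous.mul (hw i).continuous).integrable_of_hasCompactSupport hGc.mul_right
  have key : (fun x => G x * lapl v x + fderiv ℝ G x (gradient v x))
      = fun x => ∑ i, (G x * fderiv ℝ (w i) x (e i) + fderiv ℝ G x (e i) * w i x) := by
    funext x
    rw [hlap, hgr, Finset.mul_sum, Finset.sum_add_distrib]
  rw [key]
  refine ⟨continuous_finsetSum _ fun i _ => (c1 i).add (c2 i), ?_⟩
  rw [integral_finsetSum _ fun i _ => (i1 i).fun_add (i2 i)]
  refine Finset.sum_eq_zero fun i _ => ?_
  rw [integral_add (i1 i) (i2 i), integral_mul_fderiv_eq_neg_fderiv_mul_of_integrable (i2 i) (i1 i)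
    (i3 i) (fun x _ => (hG.differentiable (by norm_num)) x)
    (fun x _ => ((hw i).differentiable (by norm_num)) x)]
  ring

/-- Pointwise Young-type inequality. -/
lemma young_aux (q δ c : ℝ) (hq : 2 ≤ q) (hδ : 0 < δ) (hc : 0 < c) :
    ∃ K : ℝ, 0 < K ∧ ∀ A B g t : ℝ, 0 ≤ A → 0 ≤ B → 0 ≤ g → |t| ≤ B * g →
      δ / 2 * (A ^ q * g ^ 2) + c / 2 * A ^ q ≤
        δ * (A ^ q * g ^ 2) + c * A ^ q + q * A ^ (q - 1) * t + K * B ^ q := by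
  set L : ℝ := q ^ 2 / (δ * c) + 1 with hL
  have hL1 : 1 ≤ L := by
    have : 0 ≤ q ^ 2 / (δ * c) := by positivity
    linarith
  have hL0 : 0 < L := by linarith
  have hq0 : 0 < q := by linarith
  refine ⟨q ^ 2 / (2 * δ) * L ^ (q - 2), by positivity, ?_⟩
  intro A B g t hA hB hg ht
  rcases hA.eq_or_lt with h0 | hA0
  · subst h0
    rw [Real.zero_rpow (by linarith), Real.zero_rpow (by linarith)]
    have : 0 ≤ q ^ 2 / (2 * δ) * L ^ (q - 2) * B ^ q := by positivity
    linarith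
  set P := A ^ (q - 2) with hP
  have hP0 : 0 < P := Real.rpow_pos_of_pos hA0 _
  have e1 : A ^ q = P * A ^ 2 := by
    rw [hP, ← Real.rpow_natCast A 2, ← Real.rpow_add hA0]; norm_num
  have e2 : A ^ (q - 1) = P * A := by
    rw [hP]
    nth_rewrite 3 [← Real.rpow_one A]
    rw [← Real.rpow_add hA0]; ring_nf
  have y2 : q ^ 2 / (2 * δ) * (P * B ^ 2) ≤
      c / 2 * (P * A ^ 2) + q ^ 2 / (2 * δ) * L ^ (q - 2) * B ^ q := by
    have hBq : 0 ≤ q ^ 2 / (2 * δ) * L ^ (q - 2) * B ^ q := by positivity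
    rcases le_total (L * B) A with h | h
    · have h1 : L * B ^ 2 ≤ A ^ 2 := by
        have : (L * B) ^ 2 ≤ A ^ 2 := by gcongr
        nlinarith [mul_nonneg (mul_nonneg hL0.le (sub_nonneg.2 hL1)) (sq_nonneg B)]
      have h2 : q ^ 2 / (2 * δ) ≤ c / 2 * L := by
        have : c / 2 * L = q ^ 2 / (2 * δ) + c / 2 := by
          rw [hL]; field_simp
        linarith
      calc q ^ 2 / (2 * δ) * (P * B ^ 2) ≤ c / 2 * L * (P * B ^ 2) := by gcongr
        _ = c / 2 * (P * (L * B ^ 2)) := by ring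
        _ ≤ c / 2 * (P * A ^ 2) := by gcongr
        _ ≤ _ := by linarith
    · have hB0 : 0 < B := by
        by_contra hh
        have : B = 0 := le_antisymm (not_lt.1 hh) hB
        subst this; simp at h; linarith
      have h1 : P ≤ L ^ (q - 2) * B ^ (q - 2) := by
        rw [← Real.mul_rpow hL0.le hB]
        exact Real.rpow_le_rpow hA h (by linarith)
      have h2 : B ^ q = B ^ (q - 2) * B ^ 2 := by
        rw [← Real.rpow_natCast B 2, ← Real.rpow_add hB0]; norm_num
      have h3 : 0 ≤ c / 2 * (P * A ^ 2) := by positivity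
      calc q ^ 2 / (2 * δ) * (P * B ^ 2)
          ≤ q ^ 2 / (2 * δ) * (L ^ (q - 2) * B ^ (q - 2) * B ^ 2) := by gcongr
        _ = q ^ 2 / (2 * δ) * L ^ (q - 2) * B ^ q := by rw [h2]; ring
        _ ≤ _ := by linarith
  have y1 : q * (P * A) * (B * g) ≤ δ / 2 * (P * A ^ 2 * g ^ 2) + q ^ 2 / (2 * δ) * (P * B ^ 2) := by
    have : δ / 2 * (P * A ^ 2 * g ^ 2) + q ^ 2 / (2 * δ) * (P * B ^ 2) - q * (P * A) * (B * g)
        = P / (2 * δ) * (δ * A * g - q * B) ^ 2 := by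
      field_simp; ring
    have h2 : 0 ≤ P / (2 * δ) * (δ * A * g - q * B) ^ 2 := by positivity
    linarith
  have y0 : -(q * (P * A) * (B * g)) ≤ q * (P * A) * t := by
    have := (abs_le.1 ht).1
    have h3 : 0 ≤ q * (P * A) := by positivity
    nlinarith
  rw [e1, e2]
  linarith

/-- Cutoff functions with scaled gradient bound. -/
lemma cutoff_aux (d : ℕ) : ∃ M : ℝ, 0 < M ∧ ∀ (o : EuclideanSpace ℝ (Fin d)) (R : ℝ), 0 < R →
    ∃ η : EuclideanSpace ℝ (Fin d) → ℝ, ContDiff ℝ 1 η ∧ (∀ x, 0 ≤ η x) ∧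
      (∀ x ∈ Metric.ball o R, η x = 1) ∧ HasCompactSupport η ∧
      tsupport η ⊆ Metric.ball o (2 * R) ∧ ∀ x, ‖fderiv ℝ η x‖ ≤ M / R := by
  let b : ContDiffBump (0 : EuclideanSpace ℝ (Fin d)) := ⟨1, 3/2, by norm_num, by norm_num⟩
  have hb : ContDiff ℝ 1 b := b.contDiff
  obtain ⟨M, hM⟩ := (hb.continuous_fderiv (by norm_num)).bounded_above_of_compact_support
    (b.hasCompactSupport.fderiv ℝ)
  refine ⟨max M 1, by positivity, fun o R hR => ?_⟩
  have hlin : ContDiff ℝ 1 (fun x : EuclideanSpace ℝ (Fin d) => R⁻¹ • (x - o)) := by fun_prop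
  have hts : tsupport (fun x : EuclideanSpace ℝ (Fin d) => b (R⁻¹ • (x - o)))
      ⊆ Metric.closedBall o (3/2 * R) := by
    refine closure_minimal ?_ Metric.isClosed_closedBall
    intro x hx
    by_contra hn
    apply hx
    apply b.zero_of_le_dist
    rw [Metric.mem_closedBall, not_le, dist_eq_norm] at hn
    rw [dist_zero_right, norm_smul, norm_inv, Real.norm_of_nonneg hR.le]
    change (3/2 : ℝ) ≤ _
    rw [inv_mul_eq_div, le_div_iff₀ hR]
    exact hn.le
  refine ⟨fun x => b (R⁻¹ • (x - o)), hb.comp hlin, fun x => b.nonneg, ?_, ?_, ?_, ?_⟩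
  · intro x hx
    apply b.one_of_mem_closedBall
    rw [Metric.mem_ball, dist_eq_norm] at hx
    rw [Metric.mem_closedBall, dist_zero_right, norm_smul, norm_inv, Real.norm_of_nonneg hR.le]
    change _ ≤ (1 : ℝ)
    rw [inv_mul_eq_div, div_le_one hR]
    exact hx.le
  · exact (isCompact_closedBall o (3/2 * R)).of_isClosed_subset (isClosed_tsupport _) hts
  · refine hts.trans (Metric.closedBall_subset_ball (by linarith))
  · intro x
    have h1 : HasFDerivAt (fun x : EuclideanSpace ℝ (Fin d) => R⁻¹ • (x - o))
        (R⁻¹ • ContinuousLinearMap.id ℝ (EuclideanSpace ℝ (Fin d))) x :=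
      ((hasFDerivAt_id x).sub_const o).const_smul R⁻¹
    have h2 := ((hb.differentiable (by norm_num)) (R⁻¹ • (x - o))).hasFDerivAt.comp x h1
    have h3 : fderiv ℝ (fun x : EuclideanSpace ℝ (Fin d) => b (R⁻¹ • (x - o))) x = _ := h2.fderiv
    rw [h3, ContinuousLinearMap.comp_smul, ContinuousLinearMap.comp_id, norm_smul, norm_inv,
      Real.norm_of_nonneg hR.le, inv_mul_eq_div]
    gcongr
    exact (hM _).trans (le_max_left _ _)


/-- Euclidean-base instance of Lemma 5.3 i): integral estimates for positive solutions
of the v-equation, with a constant depending only on d, m, q. -/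
theorem integral_estimates_i
    (d : ℕ) (hd : 2 ≤ d) (m q : ℝ) (hm : 2 ≤ m) (hq1 : 2 ≤ q) (hq2 : q < m / 2 + 1) :
    ∃ C : ℝ, 0 < C ∧
      ∀ f v : EuclideanSpace ℝ (Fin d) → ℝ,
        ContDiff ℝ 2 f → ContDiff ℝ 3 v → (∀ x, 0 < v x) →
        (∀ x, lapl v x - ⟪gradient f x, gradient v x⟫
            = (1 / v x) * ((m / 2) * ‖gradient v x‖ ^ 2 + cm m)) →
        ∀ (o : EuclideanSpace ℝ (Fin d)) (R : ℝ), 0 < R →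
          (∫ x in Metric.ball o R, Real.exp (-f x) * v x ^ (-q) * ‖gradient v x‖ ^ 2)
              + (∫ x in Metric.ball o R, Real.exp (-f x) * v x ^ (-q))
            ≤ C * (∫ x in Metric.ball o (2 * R), Real.exp (-f x)) * R ^ (-q) := by
  have hc : 0 < cm m := by
    unfold cm
    split_ifs with h
    · norm_num
    · have : 0 < m - 2 := by
        rcases hm.eq_or_lt with h' | h'
        · exact absurd h'.symm h
        · linarith
      positivity
  set c := cm m with hcdef
  have hδ : 0 < m / 2 + 1 - q := by linarith
  set δ := m / 2 + 1 - q with hδdef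
  obtain ⟨K, hK, hyoung⟩ := young_aux q δ c hq1 hδ hc
  obtain ⟨M, hM, hcut⟩ := cutoff_aux d
  set κ := min (δ / 2) (c / 2) with hκ
  have hκ0 : 0 < κ := lt_min (by linarith) (by linarith)
  refine ⟨κ⁻¹ * (K * M ^ q), by positivity, ?_⟩
  intro f v hf hv hvpos heq o R hR
  obtain ⟨η, hη, hη0, hη1, hηc, hηs, hηd⟩ := hcut o R hR
  have hv1 : ContDiff ℝ 1 v := hv.of_le (by norm_num)
  have hf1 : ContDiff ℝ 1 f := hf.of_le (by norm_num)
  have hvne : ∀ x, v x ≠ 0 := fun x => (hvpos x).ne'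
  have hA1 : ContDiff ℝ 1 (fun x => η x / v x) := hη.div hv1 hvne
  have hAq : ContDiff ℝ 1 (fun x => (η x / v x) ^ q) := by
    have := ContDiff.rpow_const_of_le (m := 1) (p := q) hA1 (by push_cast; linarith)
    exact_mod_cast this
  let G : EuclideanSpace ℝ (Fin d) → ℝ := fun x => Real.exp (-f x) * v x * (η x / v x) ^ q
  have hG : ContDiff ℝ 1 G := (hf1.neg.exp.mul hv1).mul hAq
  have hGsub : Function.support G ⊆ Function.support η := by
    intro x hx h0
    apply hx
    have : (0:ℝ) ^ q = 0 := Real.zero_rpow (by linarith)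
    simp [G, h0, this]
  have hGt : tsupport G ⊆ tsupport η := closure_mono hGsub
  have hGc : HasCompactSupport G := hηc.of_isClosed_subset (isClosed_tsupport _) hGt
  obtain ⟨hHc, hH0⟩ := ibp_aux G v hG hGc (hv.of_le (by norm_num))
  set H : EuclideanSpace ℝ (Fin d) → ℝ :=
    fun x => G x * lapl v x + fderiv ℝ G x (gradient v x) with hHdef
  have hHsupp : ∀ x, x ∉ Metric.ball o (2 * R) → H x = 0 := by
    intro x hx
    have hx' : x ∉ tsupport G := fun h => hx (hηs (hGt h))
    have h1 : G x = 0 := image_eq_zero_of_notMem_tsupport hx'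
    have h2 : fderiv ℝ G x = 0 := by
      have := mt (fun h => support_fderiv_subset ℝ (f := G) h) hx'
      simpa using this
    simp [hHdef, h1, h2]
  have hHint : ∫ x in Metric.ball o (2 * R), H x = 0 := by
    rw [setIntegral_eq_integral_of_forall_compl_eq_zero (fun x hx => hHsupp x hx), hH0]
  have hHx : ∀ x, H x = Real.exp (-f x) * (δ * ((η x / v x) ^ q * ‖gradient v x‖ ^ 2)
      + c * (η x / v x) ^ q + q * (η x / v x) ^ (q - 1) * fderiv ℝ η x (gradient v x)) := by
    intro x
    have df := (hf1.differentiable (by norm_num) x).hasFDerivAt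
    have dv := (hv1.differentiable (by norm_num) x).hasFDerivAt
    have dη := (hη.differentiable (by norm_num) x).hasFDerivAt
    have dinv : HasFDerivAt (fun y => (v y)⁻¹) (-(v x ^ 2)⁻¹ • fderiv ℝ v x) x :=
      (hasDerivAt_inv (hvne x)).comp_hasFDerivAt x dv
    have ddiv : HasFDerivAt (fun y => η y / v y)
        (η x • (-(v x ^ 2)⁻¹ • fderiv ℝ v x) + (v x)⁻¹ • fderiv ℝ η x) x := by
      simp only [div_eq_mul_inv]
      exact dη.fun_mul dinv
    have dA := ddiv.rpow_const (p := q) (Or.inr (by linarith))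
    have dG := ((df.fun_neg.exp).fun_mul dv).fun_mul dA
    have hdG : fderiv ℝ G x = _ := dG.fderiv
    have hgv : fderiv ℝ v x (gradient v x) = ‖gradient v x‖ ^ 2 := by
      rw [← inner_gradient_left, real_inner_self_eq_norm_sq]
    have hgf : ⟪gradient f x, gradient v x⟫ = fderiv ℝ f x (gradient v x) := inner_gradient_left
    have hlap : lapl v x = fderiv ℝ f x (gradient v x)
        + (1 / v x) * ((m / 2) * ‖gradient v x‖ ^ 2 + c) := by
      have := heq x
      rw [hgf] at this
      linarith
    have hAA : (η x / v x) ^ q = (η x / v x) ^ (q - 1) * (η x / v x) := by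
      rcases (div_nonneg (hη0 x) (hvpos x).le).eq_or_lt with h | h
      · rw [← h, Real.zero_rpow (by linarith)]; simp
      · rw [Real.rpow_sub_one h.ne', div_mul_cancel₀ _ h.ne']
    have hvx := hvne x
    simp only [hHdef]
    rw [hdG, hlap]
    simp only [G, ContinuousLinearMap.add_apply, ContinuousLinearMap.smul_apply,
      ContinuousLinearMap.sub_apply, ContinuousLinearMap.neg_apply, smul_eq_mul, hgv]
    rw [hAA, hδdef]
    generalize (η x / v x) ^ (q - 1) = Z
    field_simp
    ring
  -- the nonnegative quantity
  set J : EuclideanSpace ℝ (Fin d) → ℝ := fun x =>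
    Real.exp (-f x) * (η x / v x) ^ q * ‖gradient v x‖ ^ 2
      + Real.exp (-f x) * (η x / v x) ^ q with hJdef
  have hgc : Continuous fun x => gradient v x := by
    unfold gradient
    exact (LinearIsometryEquiv.continuous _).comp (hv1.continuous_fderiv (by norm_num))
  have hec : Continuous fun x => Real.exp (-f x) := (hf1.neg.exp).continuous
  have hJc : Continuous J :=
    ((hec.mul hAq.continuous).mul (hgc.norm.pow 2)).add (hec.mul hAq.continuous)
  have intOn : ∀ (F : EuclideanSpace ℝ (Fin d) → ℝ), Continuous F → ∀ r,
      IntegrableOn F (Metric.ball o r) := fun F hF r =>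
    (hF.continuousOn.integrableOn_compact (isCompact_closedBall o r)).mono_set
      Metric.ball_subset_closedBall
  have hA0 : ∀ x, 0 ≤ η x / v x := fun x => div_nonneg (hη0 x) (hvpos x).le
  have hJ0 : ∀ x, 0 ≤ J x := by
    intro x
    have := Real.rpow_nonneg (hA0 x) q
    simp only [hJdef]
    positivity
  have hpt : ∀ x, κ * J x ≤ H x + K * (M / R) ^ q * Real.exp (-f x) := by
    intro x
    have hy := hyoung (η x / v x) (M / R) ‖gradient v x‖ (fderiv ℝ η x (gradient v x))
      (hA0 x) (by positivity) (norm_nonneg _)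
      (((fderiv ℝ η x).le_opNorm _).trans (by gcongr; exact hηd x))
    have hAqx := Real.rpow_nonneg (hA0 x) q
    have he := (Real.exp_pos (-f x)).le
    have k1 : κ ≤ δ / 2 := min_le_left _ _
    have k2 : κ ≤ c / 2 := min_le_right _ _
    have h1 : κ * ((η x / v x) ^ q * ‖gradient v x‖ ^ 2) + κ * (η x / v x) ^ q
        ≤ δ / 2 * ((η x / v x) ^ q * ‖gradient v x‖ ^ 2) + c / 2 * (η x / v x) ^ q := by
      gcongr
    have h2 := mul_le_mul_of_nonneg_left (h1.trans hy) he
    rw [hHx]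
    simp only [hJdef]
    linarith
  have hbig : κ * ∫ x in Metric.ball o (2 * R), J x ≤
      K * (M / R) ^ q * ∫ x in Metric.ball o (2 * R), Real.exp (-f x) := by
    have h := setIntegral_mono (intOn _ (hJc.const_mul κ) (2 * R))
      ((intOn _ hHc (2 * R)).add ((intOn _ hec (2 * R)).const_mul (K * (M / R) ^ q))) hpt
    simp only [Pi.add_apply] at h
    rw [integral_add (intOn _ hHc (2 * R)) ((intOn _ hec (2 * R)).const_mul (K * (M / R) ^ q)),
      hHint, integral_const_mul, integral_const_mul, zero_add] at h
    exact h
  have hsmall : ∫ x in Metric.ball o R, J x ≤ ∫ x in Metric.ball o (2 * R), J x :=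
    setIntegral_mono_set (intOn _ hJc _) (Eventually.of_forall hJ0)
      (LE.le.eventuallyLE (Metric.ball_subset_ball (by linarith)))
  have hvq : Continuous fun x => v x ^ (-q) :=
    hv1.continuous.rpow_const fun x => Or.inl (hvne x)
  have hLHS : (∫ x in Metric.ball o R, Real.exp (-f x) * v x ^ (-q) * ‖gradient v x‖ ^ 2)
      + (∫ x in Metric.ball o R, Real.exp (-f x) * v x ^ (-q)) = ∫ x in Metric.ball o R, J x := by
    have I1 := intOn (fun x => Real.exp (-f x) * v x ^ (-q) * ‖gradient v x‖ ^ 2)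
      ((hec.mul hvq).mul (hgc.norm.pow 2)) R
    have I2 := intOn (fun x => Real.exp (-f x) * v x ^ (-q)) (hec.mul hvq) R
    rw [← integral_add I1 I2]
    refine setIntegral_congr_fun Metric.isOpen_ball.measurableSet fun x hx => ?_
    have : (η x / v x) ^ q = v x ^ (-q) := by
      rw [hη1 x hx, one_div, Real.inv_rpow (hvpos x).le, Real.rpow_neg (hvpos x).le]
    simp only [hJdef, this]
  rw [hLHS]
  have hMR : (M / R) ^ q = M ^ q * R ^ (-q) := by
    rw [Real.div_rpow hM.le hR.le, Real.rpow_neg hR.le, div_eq_mul_inv]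
  rw [hMR] at hbig
  calc ∫ x in Metric.ball o R, J x ≤ ∫ x in Metric.ball o (2 * R), J x := hsmall
    _ = κ⁻¹ * (κ * ∫ x in Metric.ball o (2 * R), J x) := by field_simp
    _ ≤ κ⁻¹ * (K * (M ^ q * R ^ (-q)) * ∫ x in Metric.ball o (2 * R), Real.exp (-f x)) := by
        gcongr
    _ = _ := by ring
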